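/- Dual representation for Beta-randomized Brownian meanders: Let α, β > 0 and let ν be the Beta(α,β) distribution, ν(dv) = v^{α−1}(1−v)^{β−1}/B(α,β) dv on (0,1). Let d ≥ 1, 0 = s₀ < s₁ < … < s_d, and 0 ≤ t₁ < t₂ < … < t_d < 1 with t₀ = 0 and t_{d+1} = 1. Then ∫_0^1 [ ∫_{(0,∞)^d} exp(−∑_{k=1}^d ((s_{d+1−k} − s_{d−k})/√v) · u_k) · f_{v(1−t_d),…,v(1−t₁)}(u₁,…,u_d) du₁…du_d ] · (v^{α−1}(1−v)^{β−1}/B(α,β)) dv = (Γ(α+β)/(√(2π)·Γ(α))) · ∫_{(0,∞)^{d+1}} √(x₀) · ψ(β, 5/2 − α, x₀/2) · exp(−(1/2) ∑_{k=0}^d (t_{k+1} − t_k) x_k) · ∏_{k=1}^d p_{s_k − s_{k−1}}(x_{k−1}, x_k) dx₀ dx₁ … dx_d, where B(α,β) = Γ(α)Γ(β)/Γ(α+β). -/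

import Mathlib

open MeasureTheory Real Finset

/-- Transition density `p_t(x,y)` of the auxiliary Markov process `X`. -/
noncomputable def transP (t x y : ℝ) : ℝ :=
  2 * t * Real.sqrt y / (Real.pi * ((y - x) ^ 2 + 2 * (x + y) * t ^ 2 + t ^ 4))

/-- The function `ℓ_t(y)`. -/
noncomputable def ellF (t y : ℝ) : ℝ :=
  if 0 < y then y * Real.exp (-(y ^ 2) / (2 * t)) / Real.sqrt (2 * Real.pi * t ^ 3) else 0

/-- The function `g_t(y₁,y₂)`. -/
noncomputable def gF (t y₁ y₂ : ℝ) : ℝ :=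
  if 0 < y₁ ∧ 0 < y₂ then
    (1 / Real.sqrt (2 * Real.pi * t)) *
      (Real.exp (-((y₁ - y₂) ^ 2) / (2 * t)) - Real.exp (-((y₁ + y₂) ^ 2) / (2 * t)))
  else 0

/-- The joint density `f_{t₁,…,t_{n+1}}(y₁,…,y_{n+1})` of the Brownian excursion
at `n+1` time points (indexed by `Fin (n+1)`). -/
noncomputable def excDensity (n : ℕ) (t y : Fin (n + 1) → ℝ) : ℝ :=
  Real.sqrt (8 * Real.pi) * ellF (t 0) (y 0) * ellF (1 - t (Fin.last n)) (y (Fin.last n)) *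
    ∏ k : Fin n, gF (t k.succ - t k.castSucc) (y k.castSucc) (y k.succ)

/-- The confluent hypergeometric function of the second kind,
`ψ(a,b,x) = (1/Γ(a)) ∫_0^∞ e^{−xu} u^{a−1} (1+u)^{b−a−1} du`. -/
noncomputable def psiCH (a b x : ℝ) : ℝ :=
  (1 / Real.Gamma a) *
    ∫ u in Set.Ioi (0 : ℝ), Real.exp (-(x * u)) * u ^ (a - 1) * (1 + u) ^ (b - a - 1)

lemma gauss_cos (τ : ℝ) (hτ : 0 < τ) (y : ℝ) :
    ∫ z in Set.Ioi (0 : ℝ), Real.cos (y * z) * Real.exp (-(τ * z ^ 2 / 2)) =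
      Real.pi * (1 / Real.sqrt (2 * Real.pi * τ)) * Real.exp (-(y ^ 2) / (2 * τ)) := by
  have h1 : ∫ z : ℝ, Real.cos (y * z) * Real.exp (-(τ * z ^ 2 / 2)) =
      2 * ∫ z in Set.Ioi (0 : ℝ), Real.cos (y * z) * Real.exp (-(τ * z ^ 2 / 2)) := by
    rw [← integral_comp_abs]
    congr 1; ext z
    rw [sq_abs]
    rcases abs_choice z with h | h <;> rw [h]
    rw [mul_neg, Real.cos_neg]
  have hb : 0 < ((τ / 2 : ℝ) : ℂ).re := by simp; exact hτ
  have h2 := fourierIntegral_gaussian hb (y : ℂ)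
  have hint : Integrable (fun x : ℝ => Complex.exp (Complex.I * y * x) * Complex.exp (-((τ / 2 : ℝ) : ℂ) * x ^ 2)) := by
    have h3 := (integrable_exp_neg_mul_sq (half_pos hτ))
    have h4 : Integrable (fun x : ℝ => Complex.exp (-((τ / 2 : ℝ) : ℂ) * x ^ 2)) := by
      convert h3.ofReal (𝕜 := ℂ) using 2 with x
      simp
    refine h4.bdd_mul (c := 1) (by fun_prop) (Filter.Eventually.of_forall fun x => ?_)
    rw [show Complex.I * y * x = ((y * x : ℝ) : ℂ) * Complex.I by push_cast; ring]
    rw [Complex.norm_exp_ofReal_mul_I]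
  have h5 := congrArg Complex.re h2
  have h6 : (∫ x : ℝ, Complex.exp (Complex.I * y * x) * Complex.exp (-((τ / 2 : ℝ) : ℂ) * x ^ 2)).re =
      ∫ z : ℝ, Real.cos (y * z) * Real.exp (-(τ * z ^ 2 / 2)) := by
    rw [← RCLike.re_eq_complex_re, ← integral_re hint]
    congr 1; ext x
    rw [RCLike.re_eq_complex_re, show Complex.I * y * x = ((y * x : ℝ) : ℂ) * Complex.I by push_cast; ring,
      show (-((τ / 2 : ℝ) : ℂ) * x ^ 2) = ((-(τ * x ^ 2 / 2) : ℝ) : ℂ) by push_cast; ring, ← Complex.ofReal_exp,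
      Complex.re_mul_ofReal, Complex.exp_ofReal_mul_I_re]
  rw [h6, h1] at h5
  have h7 : ((Real.pi : ℂ) / ((τ / 2 : ℝ) : ℂ)) ^ (1 / 2 : ℂ) * Complex.exp (-(y : ℂ) ^ 2 / (4 * ((τ / 2 : ℝ) : ℂ)))
     = ((Real.sqrt (Real.pi / (τ / 2)) * Real.exp (-(y ^ 2) / (2 * τ)) : ℝ) : ℂ) := by
    rw [Real.sqrt_eq_rpow]
    push_cast
    rw [Complex.ofReal_cpow (by positivity)]
    push_cast
    congr 2
    ring_nf
  rw [h7, Complex.ofReal_re] at h5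
  have h8 : Real.sqrt (Real.pi / (τ / 2)) = 2 * (Real.pi * (1 / Real.sqrt (2 * Real.pi * τ))) := by
    rw [Real.sqrt_eq_iff_mul_self_eq (by positivity) (by positivity)]
    have : Real.sqrt (2 * Real.pi * τ) * Real.sqrt (2 * Real.pi * τ) = 2 * Real.pi * τ :=
      Real.mul_self_sqrt (by positivity)
    field_simp
    ring_nf at this ⊢
    linarith
  rw [h8] at h5
  linarith

lemma gauss_int (τ : ℝ) (hτ : 0 < τ) :
    Integrable (fun z : ℝ => Real.exp (-(τ * z ^ 2 / 2))) := by
  convert integrable_exp_neg_mul_sq (half_pos hτ) using 3 with z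
  ring

lemma gauss_int1 (τ : ℝ) (hτ : 0 < τ) :
    Integrable (fun z : ℝ => z * Real.exp (-(τ * z ^ 2 / 2))) := by
  convert integrable_mul_exp_neg_mul_sq (half_pos hτ) using 4 with z
  ring

lemma gF_eq (τ : ℝ) (hτ : 0 < τ) (a b : ℝ) (ha : 0 < a) (hb : 0 < b) :
    gF τ a b = ∫ z in Set.Ioi (0 : ℝ), Real.sin (b * z) * (2 / Real.pi * Real.sin (a * z) * Real.exp (-(τ * z ^ 2 / 2))) := by
  have h : ∀ c : ℝ, Integrable (fun z : ℝ => Real.cos (c * z) * Real.exp (-(τ * z ^ 2 / 2))) := fun c =>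
    (gauss_int τ hτ).bdd_mul (c := 1) (by fun_prop) (Filter.Eventually.of_forall fun x => Real.abs_cos_le_one _)
  have e : ∀ z : ℝ, Real.sin (b * z) * (2 / Real.pi * Real.sin (a * z) * Real.exp (-(τ * z ^ 2 / 2))) =
     (1 / Real.pi) * (Real.cos ((a - b) * z) * Real.exp (-(τ * z ^ 2 / 2)) - Real.cos ((a + b) * z) * Real.exp (-(τ * z ^ 2 / 2))) := by
    intro z
    rw [sub_mul, add_mul, Real.cos_sub, Real.cos_add]
    ring
  simp_rw [e]
  rw [integral_const_mul, integral_sub (h _).integrableOn (h _).integrableOn, gauss_cos τ hτ, gauss_cos τ hτ, gF, if_pos ⟨ha, hb⟩]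
  field_simp

lemma ellF_eq (τ : ℝ) (hτ : 0 < τ) (b : ℝ) (hb : 0 < b) :
    ellF τ b = ∫ z in Set.Ioi (0 : ℝ), Real.sin (b * z) * (1 / Real.pi * z * Real.exp (-(τ * z ^ 2 / 2))) := by
  have i1 : IntegrableOn (fun z : ℝ => Real.sin (b * z) * (z * Real.exp (-(τ * z ^ 2 / 2)))) (Set.Ioi 0) :=
    ((gauss_int1 τ hτ).bdd_mul (c := 1) (by fun_prop) (Filter.Eventually.of_forall fun x => Real.abs_sin_le_one _)).integrableOn
  have i2 : IntegrableOn (fun z : ℝ => Real.cos (b * z) * Real.exp (-(τ * z ^ 2 / 2))) (Set.Ioi 0) :=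
    ((gauss_int τ hτ).bdd_mul (c := 1) (by fun_prop) (Filter.Eventually.of_forall fun x => Real.abs_cos_le_one _)).integrableOn
  have hexp : Filter.Tendsto (fun z : ℝ => Real.exp (-(τ * z ^ 2 / 2))) Filter.atTop (nhds 0) := by
    apply Real.tendsto_exp_neg_atTop_nhds_zero.comp
    apply Filter.Tendsto.atTop_div_const (by norm_num)
    exact (Filter.tendsto_pow_atTop (by norm_num)).const_mul_atTop hτ
  have h := integral_Ioi_of_hasDerivAt_of_tendsto (a := 0) (m := 0)
    (f := fun z : ℝ => Real.sin (b * z) * Real.exp (-(τ * z ^ 2 / 2)))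
    (f' := fun z : ℝ => b * (Real.cos (b * z) * Real.exp (-(τ * z ^ 2 / 2))) -
      τ * (Real.sin (b * z) * (z * Real.exp (-(τ * z ^ 2 / 2)))))
    (by fun_prop) (fun z _ => by
      have h1 : HasDerivAt (fun z : ℝ => Real.sin (b * z)) (Real.cos (b * z) * (b * 1)) z :=
        ((hasDerivAt_id z).const_mul b).sin
      have h2 : HasDerivAt (fun z : ℝ => Real.exp (-(τ * z ^ 2 / 2))) (Real.exp (-(τ * z ^ 2 / 2)) * (-(τ * (2 * z) / 2))) z := by
        have := ((((hasDerivAt_pow 2 z).const_mul τ).div_const 2).neg).exp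
        simpa using this
      refine (h1.mul h2).congr_deriv ?_
      ring)
    ((i2.const_mul b).sub (i1.const_mul τ))
    (by
      apply squeeze_zero_norm (a := fun z : ℝ => Real.exp (-(τ * z ^ 2 / 2))) _ hexp
      intro z
      rw [norm_mul, Real.norm_eq_abs, Real.norm_eq_abs, Real.abs_exp]
      exact mul_le_of_le_one_left (Real.exp_pos _).le (Real.abs_sin_le_one _))
  rw [integral_sub (i2.const_mul b) (i1.const_mul τ), integral_const_mul, integral_const_mul, gauss_cos τ hτ] at h
  simp only [mul_zero, Real.sin_zero, zero_mul, sub_zero] at h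
  have e : ∀ z : ℝ, Real.sin (b * z) * (1 / Real.pi * z * Real.exp (-(τ * z ^ 2 / 2))) =
     (1 / Real.pi) * (Real.sin (b * z) * (z * Real.exp (-(τ * z ^ 2 / 2)))) := by
    intro z; ring
  simp_rw [e]
  rw [integral_const_mul, ellF, if_pos hb]
  have hs : Real.sqrt (2 * Real.pi * τ ^ 3) = τ * Real.sqrt (2 * Real.pi * τ) := by
    rw [show 2 * Real.pi * τ ^ 3 = τ ^ 2 * (2 * Real.pi * τ) by ring, Real.sqrt_mul (by positivity), Real.sqrt_sq hτ.le]
  rw [hs]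
  have h3 : (∫ z in Set.Ioi (0 : ℝ), Real.sin (b * z) * (z * Real.exp (-(τ * z ^ 2 / 2)))) =
    b * (Real.pi * (1 / Real.sqrt (2 * Real.pi * τ)) * Real.exp (-(b ^ 2) / (2 * τ))) / τ := by
    rw [eq_div_iff hτ.ne']
    linarith
  rw [h3]
  have : 0 < Real.sqrt (2 * Real.pi * τ) := by positivity
  field_simp

lemma exp_int (δ : ℝ) (hδ : 0 < δ) : IntegrableOn (fun w : ℝ => Real.exp (-(δ * w))) (Set.Ioi 0) := by
  simpa using exp_neg_integrableOn_Ioi 0 hδ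

lemma laplace_cos (δ : ℝ) (hδ : 0 < δ) (c : ℝ) :
    ∫ w in Set.Ioi (0 : ℝ), Real.exp (-(δ * w)) * Real.cos (c * w) = δ / (δ ^ 2 + c ^ 2) := by
  have hexp : Filter.Tendsto (fun w : ℝ => Real.exp (-(δ * w))) Filter.atTop (nhds 0) :=
    Real.tendsto_exp_neg_atTop_nhds_zero.comp (Filter.tendsto_id.const_mul_atTop hδ)
  have hD : 0 < δ ^ 2 + c ^ 2 := by positivity
  have h := integral_Ioi_of_hasDerivAt_of_tendsto (a := 0) (m := 0)
    (f := fun w : ℝ => (c * Real.sin (c * w) - δ * Real.cos (c * w)) / (δ ^ 2 + c ^ 2) * Real.exp (-(δ * w)))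
    (f' := fun w : ℝ => Real.exp (-(δ * w)) * Real.cos (c * w))
    (by fun_prop) (fun w _ => by
      have h1 : HasDerivAt (fun z : ℝ => Real.sin (c * z)) (Real.cos (c * w) * (c * 1)) w :=
        ((hasDerivAt_id w).const_mul c).sin
      have h2 : HasDerivAt (fun z : ℝ => Real.cos (c * z)) (-Real.sin (c * w) * (c * 1)) w :=
        ((hasDerivAt_id w).const_mul c).cos
      have h3 : HasDerivAt (fun z : ℝ => Real.exp (-(δ * z))) (Real.exp (-(δ * w)) * (-(δ * 1))) w :=
        (((hasDerivAt_id w).const_mul δ).neg).exp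
      refine ((((h1.const_mul c).sub (h2.const_mul δ)).div_const (δ ^ 2 + c ^ 2)).mul h3).congr_deriv ?_
      simp only [Pi.sub_apply]
      field_simp
      ring)
    (by
      have := (exp_int δ hδ).bdd_mul (f := fun w : ℝ => Real.cos (c * w)) (c := 1) (by fun_prop) (Filter.Eventually.of_forall fun x => Real.abs_cos_le_one _)
      simpa only [mul_comm, IntegrableOn] using this)
    (by
      have hexp2 := hexp.const_mul ((|c| + δ) / (δ ^ 2 + c ^ 2))
      rw [mul_zero] at hexp2
      apply squeeze_zero_norm _ hexp2
      intro w
      rw [norm_mul, Real.norm_eq_abs, Real.norm_eq_abs, Real.abs_exp, abs_div, abs_of_pos hD]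
      gcongr
      refine (abs_sub _ _).trans ?_
      rw [abs_mul, abs_mul, abs_of_pos hδ]
      have := Real.abs_sin_le_one (c * w)
      have := Real.abs_cos_le_one (c * w)
      gcongr
      · exact mul_le_of_le_one_right (abs_nonneg _) (by assumption)
      · exact mul_le_of_le_one_right hδ.le (by assumption))
  rw [h]
  simp
  ring

lemma laplace_sin_sin (δ : ℝ) (hδ : 0 < δ) (a b : ℝ) (hb : 0 ≤ b) :
    ∫ w in Set.Ioi (0 : ℝ), Real.exp (-(δ * w)) * (Real.sin (w * a) * Real.sin (w * b)) =
      Real.pi * a * transP δ (a ^ 2) (b ^ 2) := by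
  have h : ∀ c : ℝ, IntegrableOn (fun w : ℝ => Real.exp (-(δ * w)) * Real.cos (c * w)) (Set.Ioi 0) := fun c => by
    have := (exp_int δ hδ).bdd_mul (f := fun w : ℝ => Real.cos (c * w)) (c := 1) (by fun_prop) (Filter.Eventually.of_forall fun x => Real.abs_cos_le_one _)
    simpa only [mul_comm, IntegrableOn] using this
  have e : ∀ w : ℝ, Real.exp (-(δ * w)) * (Real.sin (w * a) * Real.sin (w * b)) =
     (1 / 2) * (Real.exp (-(δ * w)) * Real.cos ((a - b) * w) - Real.exp (-(δ * w)) * Real.cos ((a + b) * w)) := by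
    intro w
    rw [sub_mul, add_mul, Real.cos_sub, Real.cos_add, mul_comm w a, mul_comm w b]
    ring
  simp_rw [e]
  rw [integral_const_mul, integral_sub (h _) (h _), laplace_cos δ hδ, laplace_cos δ hδ, transP, Real.sqrt_sq hb]
  have h1 : 0 < δ ^ 2 + (a - b) ^ 2 := by positivity
  have h2 : 0 < δ ^ 2 + (a + b) ^ 2 := by positivity
  rw [show (b ^ 2 - a ^ 2) ^ 2 + 2 * (a ^ 2 + b ^ 2) * δ ^ 2 + δ ^ 4 = (δ ^ 2 + (a - b) ^ 2) * (δ ^ 2 + (a + b) ^ 2) by ring]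
  field_simp
  ring

lemma subst_sq (f : ℝ → ℝ) :
    ∫ y in Set.Ioi (0 : ℝ), f y = ∫ z in Set.Ioi (0 : ℝ), 2 * z * f (z ^ 2) := by
  rw [← integral_comp_rpow_Ioi_of_pos (p := 2) (by norm_num)]
  refine setIntegral_congr_fun measurableSet_Ioi fun z _ => ?_
  norm_num

def GoodPair (A B : ℝ → ℝ) : Prop :=
  Measurable A ∧ Measurable B ∧
    (∃ C c : ℝ, 0 < c ∧ ∀ x, 0 < x → 0 ≤ B x ∧ B x ≤ C * Real.exp (-(c * x))) ∧
    ∀ w, 0 < w → 0 ≤ A w ∧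
      A w = 1 / Real.pi * ∫ z in Set.Ioi (0 : ℝ), Real.sin (w * z) * (z * B (z ^ 2))

lemma transP_nonneg {δ x y : ℝ} (hδ : 0 < δ) (hx : 0 ≤ x) (hy : 0 ≤ y) : 0 ≤ transP δ x y := by
  unfold transP; positivity

lemma transP_le {δ x y : ℝ} (hδ : 0 < δ) (hx : 0 ≤ x) (hy : 0 ≤ y) :
    transP δ x y ≤ 2 * δ / (Real.pi * δ ^ 4) * Real.sqrt y := by
  unfold transP
  rw [div_mul_eq_mul_div]
  gcongr
  have : 0 ≤ (y - x) ^ 2 + 2 * (x + y) * δ ^ 2 := by positivity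
  linarith

lemma transP_meas (δ : ℝ) : Measurable (fun p : ℝ × ℝ => transP δ p.1 p.2) := by
  unfold transP; fun_prop

lemma gF_meas (τ : ℝ) : Measurable (fun p : ℝ × ℝ => gF τ p.1 p.2) := by
  unfold gF
  refine Measurable.ite ?_ (by fun_prop) (by fun_prop)
  exact (measurableSet_lt measurable_const measurable_fst).inter (measurableSet_lt measurable_const measurable_snd)

lemma ellF_meas (τ : ℝ) : Measurable (fun p : ℝ => ellF τ p) := by
  unfold ellF
  exact Measurable.ite (measurableSet_lt measurable_const measurable_id) (by fun_prop) (by fun_prop)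

lemma gF_nonneg (τ a b : ℝ) (hτ : 0 < τ) : 0 ≤ gF τ a b := by
  unfold gF
  split_ifs with h
  · have h1 := h.1
    have h2 := h.2
    have : Real.exp (-((a + b) ^ 2) / (2 * τ)) ≤ Real.exp (-((a - b) ^ 2) / (2 * τ)) := by
      apply Real.exp_le_exp.2
      gcongr ?_ / _
      nlinarith [mul_pos h1 h2]
    apply mul_nonneg (by positivity) (by linarith)
  · exact le_rfl

lemma ellF_nonneg (τ a : ℝ) : 0 ≤ ellF τ a := by
  unfold ellF
  split_ifs with h
  · positivity
  · exact le_rfl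

lemma sq_int {B : ℝ → ℝ} (hB : Measurable B) {C c : ℝ} (hc : 0 < c)
    (h : ∀ x, 0 < x → 0 ≤ B x ∧ B x ≤ C * Real.exp (-(c * x))) :
    IntegrableOn (fun z : ℝ => z * B (z ^ 2)) (Set.Ioi 0) := by
  have h1 : IntegrableOn (fun z : ℝ => C * (z * Real.exp (-(2 * c * z ^ 2 / 2)))) (Set.Ioi 0) :=
    ((gauss_int1 (2 * c) (by positivity)).const_mul C).integrableOn
  refine Integrable.mono' h1 (by fun_prop) ?_
  refine (ae_restrict_iff' measurableSet_Ioi).2 (Filter.Eventually.of_forall fun z hz => ?_)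
  have hz : (0 : ℝ) < z := hz
  have := h (z ^ 2) (by positivity)
  rw [Real.norm_eq_abs, abs_of_nonneg (mul_nonneg hz.le this.1), mul_left_comm,
    show 2 * c * z ^ 2 / 2 = c * z ^ 2 by ring]
  exact mul_le_mul_of_nonneg_left this.2 hz.le

lemma core_swap {A B φ : ℝ → ℝ} (hAB : GoodPair A B) {δ : ℝ} (hδ : 0 < δ)
    (hφ : IntegrableOn φ (Set.Ioi 0)) :
    IntegrableOn (fun w => Real.exp (-(δ * w)) * (∫ z in Set.Ioi (0 : ℝ), Real.sin (w * z) * φ z) * A w) (Set.Ioi 0) ∧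
    ∫ w in Set.Ioi (0 : ℝ), Real.exp (-(δ * w)) * (∫ z in Set.Ioi (0 : ℝ), Real.sin (w * z) * φ z) * A w =
      ∫ z in Set.Ioi (0 : ℝ), φ z * (z / 2 * ∫ y in Set.Ioi (0 : ℝ), transP δ (z ^ 2) y * B y) := by
  obtain ⟨hA, hB, ⟨C, c, hc, hbd⟩, hw⟩ := hAB
  set μ : Measure ℝ := volume.restrict (Set.Ioi 0) with hμ
  have hψ : Integrable (fun z : ℝ => z * B (z ^ 2)) μ := sq_int hB hc hbd
  have hφ' : Integrable φ μ := hφ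
  have hK : Integrable (Function.uncurry fun (w : ℝ) (p : ℝ × ℝ) =>
      (Real.sin (w * p.1) * Real.sin (w * p.2)) * (Real.exp (-(δ * w)) * (φ p.1 * (p.2 * B (p.2 ^ 2))))) (μ.prod (μ.prod μ)) := by
    have h0 := Integrable.mul_prod (f := fun w => Real.exp (-(δ * w))) (exp_int δ hδ) (hφ'.mul_prod hψ)
    refine h0.bdd_mul (f := fun q : ℝ × (ℝ × ℝ) => Real.sin (q.1 * q.2.1) * Real.sin (q.1 * q.2.2)) (c := 1) ?_ ?_
    · fun_prop
    · refine Filter.Eventually.of_forall fun q => ?_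
      rw [norm_mul]
      exact mul_le_one₀ (Real.abs_sin_le_one _) (norm_nonneg _) (Real.abs_sin_le_one _)
  have e1 : ∀ w ∈ Set.Ioi (0 : ℝ), Real.exp (-(δ * w)) * (∫ z in Set.Ioi (0 : ℝ), Real.sin (w * z) * φ z) * A w =
     1 / Real.pi * ∫ p, (Real.sin (w * p.1) * Real.sin (w * p.2)) * (Real.exp (-(δ * w)) * (φ p.1 * (p.2 * B (p.2 ^ 2)))) ∂(μ.prod μ) := by
    intro w hw0
    rw [(hw w hw0).2]
    have : ∀ p : ℝ × ℝ, (Real.sin (w * p.1) * Real.sin (w * p.2)) * (Real.exp (-(δ * w)) * (φ p.1 * (p.2 * B (p.2 ^ 2)))) =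
      Real.exp (-(δ * w)) * ((Real.sin (w * p.1) * φ p.1) * (Real.sin (w * p.2) * (p.2 * B (p.2 ^ 2)))) := by intro p; ring
    simp_rw [this]
    rw [integral_const_mul, integral_prod_mul (fun z => Real.sin (w * z) * φ z) (fun z => Real.sin (w * z) * (z * B (z ^ 2)))]
    ring
  constructor
  · have h2 := (hK.integral_prod_left).const_mul (1 / Real.pi)
    refine IntegrableOn.congr_fun (f := fun w => 1 / Real.pi * ∫ p, (Real.sin (w * p.1) * Real.sin (w * p.2)) * (Real.exp (-(δ * w)) * (φ p.1 * (p.2 * B (p.2 ^ 2)))) ∂(μ.prod μ)) h2 (fun w hw0 => (e1 w hw0).symm) measurableSet_Ioi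
  · rw [setIntegral_congr_fun measurableSet_Ioi e1, integral_const_mul, integral_integral_swap hK]
    have hR := integral_prod _ hK.integral_prod_right
    simp only [Function.uncurry_apply_pair] at hR
    rw [hR, ← integral_const_mul]
    refine integral_congr_ae (Filter.Eventually.of_forall fun z => ?_)
    simp only
    rw [subst_sq (fun y => transP δ (z ^ 2) y * B y)]
    rw [← integral_const_mul, ← integral_const_mul, ← integral_const_mul]
    refine setIntegral_congr_fun measurableSet_Ioi fun y hy => ?_
    have hy : (0 : ℝ) < y := hy
    have h9 : ∫ w, (Real.sin (w * z) * Real.sin (w * y)) * (Real.exp (-(δ * w)) * (φ z * (y * B (y ^ 2)))) ∂μ =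
       (∫ w in Set.Ioi (0 : ℝ), (Real.exp (-(δ * w)) * (Real.sin (w * z) * Real.sin (w * y)))) * (φ z * y * B (y ^ 2)) := by
      rw [← integral_mul_const]
      refine integral_congr_ae (Filter.Eventually.of_forall fun w => ?_)
      beta_reduce
      ring
    rw [laplace_sin_sin δ hδ z y hy.le] at h9
    rw [h9]
    field_simp

lemma transP_int {B : ℝ → ℝ} (hB : Measurable B) {C c : ℝ} (hc : 0 < c)
    (h : ∀ x, 0 < x → 0 ≤ B x ∧ B x ≤ C * Real.exp (-(c * x))) {δ : ℝ} (hδ : 0 < δ) :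
    (∀ x, 0 ≤ x → IntegrableOn (fun y => transP δ x y * B y) (Set.Ioi 0)) ∧
    (∀ x, 0 ≤ x → 0 ≤ ∫ y in Set.Ioi (0 : ℝ), transP δ x y * B y) ∧
    ∃ M, ∀ x, 0 ≤ x → ∫ y in Set.Ioi (0 : ℝ), transP δ x y * B y ≤ M := by
  have h1 : IntegrableOn (fun y : ℝ => 2 * δ / (Real.pi * δ ^ 4) * C * (y ^ (1 / 2 : ℝ) * Real.exp (-c * y ^ (1 : ℝ)))) (Set.Ioi 0) :=
    (integrableOn_rpow_mul_exp_neg_mul_rpow (by norm_num) (by norm_num) hc).const_mul _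
  have h2 : ∀ x, 0 ≤ x → ∀ y ∈ Set.Ioi (0 : ℝ), transP δ x y * B y ≤ 2 * δ / (Real.pi * δ ^ 4) * C * (y ^ (1 / 2 : ℝ) * Real.exp (-c * y ^ (1 : ℝ))) := by
    intro x hx y hy
    have hy : (0 : ℝ) < y := hy
    have := mul_le_mul (transP_le hδ hx hy.le) (h y hy).2 (h y hy).1 (by positivity)
    rw [← Real.sqrt_eq_rpow, Real.rpow_one, neg_mul]
    linarith
  have h3 : ∀ x, 0 ≤ x → ∀ y ∈ Set.Ioi (0 : ℝ), 0 ≤ transP δ x y * B y := fun x hx y hy =>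
    mul_nonneg (transP_nonneg hδ hx (le_of_lt hy)) (h y hy).1
  have h4 : ∀ x, 0 ≤ x → IntegrableOn (fun y => transP δ x y * B y) (Set.Ioi 0) := by
    intro x hx
    refine Integrable.mono' h1 ?_ ?_
    · exact (((transP_meas δ).comp (measurable_const.prodMk measurable_id)).mul hB).aestronglyMeasurable
    · refine (ae_restrict_iff' measurableSet_Ioi).2 (Filter.Eventually.of_forall fun y hy => ?_)
      rw [Real.norm_eq_abs, abs_of_nonneg (h3 x hx y hy)]
      exact h2 x hx y hy
  refine ⟨h4, fun x hx => setIntegral_nonneg measurableSet_Ioi (h3 x hx), _, fun x hx => setIntegral_mono_on (h4 x hx) h1 measurableSet_Ioi (h2 x hx)⟩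

lemma Q_meas {B : ℝ → ℝ} (hB : Measurable B) (δ : ℝ) :
    Measurable (fun x => ∫ y in Set.Ioi (0 : ℝ), transP δ x y * B y) := by
  apply StronglyMeasurable.measurable
  apply StronglyMeasurable.integral_prod_right
  apply Measurable.stronglyMeasurable
  exact (transP_meas δ).mul (hB.comp measurable_snd)

lemma good_base (τ : ℝ) (hτ : 0 < τ) : GoodPair (ellF τ) (fun x => Real.exp (-(τ * x / 2))) := by
  refine ⟨ellF_meas τ, by fun_prop, ⟨1, τ / 2, by positivity, fun x hx => ⟨by positivity, ?_⟩⟩, fun w hw => ⟨ellF_nonneg _ _, ?_⟩⟩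
  · show Real.exp (-(τ * x / 2)) ≤ _
    rw [one_mul]; apply le_of_eq; congr 1; ring
  · rw [ellF_eq τ hτ w hw, ← integral_const_mul]
    refine setIntegral_congr_fun measurableSet_Ioi fun z _ => ?_
    simp only
    ring

lemma good_step {A B : ℝ → ℝ} (hAB : GoodPair A B) {δ τ : ℝ} (hδ : 0 < δ) (hτ : 0 < τ) :
    GoodPair (fun w => ∫ w' in Set.Ioi (0 : ℝ), gF τ w w' * Real.exp (-(δ * w')) * A w')
      (fun x => ∫ y in Set.Ioi (0 : ℝ), Real.exp (-(τ * x / 2)) * transP δ x y * B y) ∧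
    (∀ w, 0 < w → IntegrableOn (fun w' => gF τ w w' * Real.exp (-(δ * w')) * A w') (Set.Ioi 0)) ∧
    (∀ x, 0 < x → IntegrableOn (fun y => Real.exp (-(τ * x / 2)) * transP δ x y * B y) (Set.Ioi 0)) := by
  obtain ⟨hA, hB, ⟨C, c, hc, hbd⟩, hw⟩ := id hAB
  obtain ⟨t1, t2, M, t3⟩ := transP_int hB hc hbd hδ
  have hφ : ∀ w : ℝ, IntegrableOn (fun z : ℝ => 2 / Real.pi * Real.sin (w * z) * Real.exp (-(τ * z ^ 2 / 2))) (Set.Ioi 0) := by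
    intro w
    have := (((gauss_int τ hτ).bdd_mul (f := fun z => Real.sin (w * z)) (c := 1) (by fun_prop) (Filter.Eventually.of_forall fun x => Real.abs_sin_le_one _)).const_mul (2 / Real.pi)).integrableOn (s := Set.Ioi 0)
    simpa only [mul_assoc] using this
  have e1 : ∀ w, 0 < w → ∀ w' ∈ Set.Ioi (0 : ℝ), Real.exp (-(δ * w')) * (∫ z in Set.Ioi (0 : ℝ), Real.sin (w' * z) * (2 / Real.pi * Real.sin (w * z) * Real.exp (-(τ * z ^ 2 / 2)))) * A w' =
      gF τ w w' * Real.exp (-(δ * w')) * A w' := by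
    intro w hw w' hw'
    rw [gF_eq τ hτ w w' hw hw']
    ring
  have e2 : ∀ x : ℝ, (∫ y in Set.Ioi (0 : ℝ), Real.exp (-(τ * x / 2)) * transP δ x y * B y) =
      Real.exp (-(τ * x / 2)) * ∫ y in Set.Ioi (0 : ℝ), transP δ x y * B y := by
    intro x
    rw [← integral_const_mul]
    simp only [mul_assoc]
  refine ⟨⟨?_, ?_, ?_, ?_⟩, ?_, ?_⟩
  · apply StronglyMeasurable.measurable
    apply StronglyMeasurable.integral_prod_right
    apply Measurable.stronglyMeasurable
    exact ((gF_meas τ).mul (by fun_prop)).mul (hA.comp measurable_snd)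
  · simp_rw [e2]
    exact Measurable.mul (by fun_prop) (Q_meas hB δ)
  · refine ⟨M, τ / 2, by positivity, fun x hx => ?_⟩
    beta_reduce
    rw [e2]
    refine ⟨mul_nonneg (Real.exp_pos _).le (t2 x hx.le), ?_⟩
    rw [mul_comm, show τ / 2 * x = τ * x / 2 by ring]
    gcongr
    exact t3 x hx.le
  · intro w hw0
    refine ⟨setIntegral_nonneg measurableSet_Ioi fun w' hw' => mul_nonneg (mul_nonneg (gF_nonneg _ _ _ hτ) (Real.exp_pos _).le) (hw w' hw').1, ?_⟩
    beta_reduce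
    rw [← setIntegral_congr_fun measurableSet_Ioi (e1 w hw0), (core_swap hAB hδ (hφ w)).2, ← integral_const_mul]
    refine setIntegral_congr_fun measurableSet_Ioi fun z _ => ?_
    simp only [e2]
    ring
  · intro w hw0
    exact (core_swap hAB hδ (hφ w)).1.congr_fun (e1 w hw0) measurableSet_Ioi
  · intro x hx
    simpa only [mul_assoc, IntegrableOn] using (t1 x hx.le).const_mul (Real.exp (-(τ * x / 2)))

lemma good_final {A B : ℝ → ℝ} (hAB : GoodPair A B) {δ τ : ℝ} (hδ : 0 < δ) (hτ : 0 < τ) :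
    IntegrableOn (fun w => ellF τ w * Real.exp (-(δ * w)) * A w) (Set.Ioi 0) ∧
    IntegrableOn (fun x => Real.sqrt x * Real.exp (-(τ * x / 2)) * ∫ y in Set.Ioi (0 : ℝ), transP δ x y * B y) (Set.Ioi 0) ∧
    ∫ w in Set.Ioi (0 : ℝ), ellF τ w * Real.exp (-(δ * w)) * A w =
      1 / (4 * Real.pi) * ∫ x in Set.Ioi (0 : ℝ), Real.sqrt x * Real.exp (-(τ * x / 2)) * ∫ y in Set.Ioi (0 : ℝ), transP δ x y * B y := by
  obtain ⟨hA, hB, ⟨C, c, hc, hbd⟩, hw⟩ := id hAB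
  obtain ⟨t1, t2, M, t3⟩ := transP_int hB hc hbd hδ
  have hφ : IntegrableOn (fun z : ℝ => 1 / Real.pi * z * Real.exp (-(τ * z ^ 2 / 2))) (Set.Ioi 0) := by
    have := ((gauss_int1 τ hτ).const_mul (1 / Real.pi)).integrableOn (s := Set.Ioi 0)
    simpa only [mul_assoc] using this
  have e1 : ∀ w' ∈ Set.Ioi (0 : ℝ), Real.exp (-(δ * w')) * (∫ z in Set.Ioi (0 : ℝ), Real.sin (w' * z) * (1 / Real.pi * z * Real.exp (-(τ * z ^ 2 / 2)))) * A w' =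
      ellF τ w' * Real.exp (-(δ * w')) * A w' := by
    intro w' hw'
    rw [ellF_eq τ hτ w' hw']
    ring
  refine ⟨(core_swap hAB hδ hφ).1.congr_fun e1 measurableSet_Ioi, ?_, ?_⟩
  · have h1 : IntegrableOn (fun y : ℝ => M * (y ^ (1 / 2 : ℝ) * Real.exp (-(τ / 2) * y ^ (1 : ℝ)))) (Set.Ioi 0) :=
      (integrableOn_rpow_mul_exp_neg_mul_rpow (by norm_num) (by norm_num) (by positivity)).const_mul _
    refine Integrable.mono' h1 ?_ ?_
    · exact (Measurable.mul (by fun_prop) (Q_meas hB δ)).aestronglyMeasurable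
    · refine (ae_restrict_iff' measurableSet_Ioi).2 (Filter.Eventually.of_forall fun x hx => ?_)
      have hx : (0 : ℝ) < x := hx
      rw [Real.norm_eq_abs, abs_of_nonneg (mul_nonneg (by positivity) (t2 x hx.le)), mul_comm M, ← Real.sqrt_eq_rpow, Real.rpow_one, show -(τ * x / 2) = -(τ / 2) * x by ring]
      gcongr
      exact t3 x hx.le
  · rw [← setIntegral_congr_fun measurableSet_Ioi e1, (core_swap hAB hδ hφ).2, subst_sq (fun x => Real.sqrt x * Real.exp (-(τ * x / 2)) * ∫ y in Set.Ioi (0 : ℝ), transP δ x y * B y), ← integral_const_mul]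
    refine setIntegral_congr_fun measurableSet_Ioi fun z hz => ?_
    have hz : (0 : ℝ) < z := hz
    rw [Real.sqrt_sq hz.le]
    ring

noncomputable def chainI : (n : ℕ) → (Fin n → ℝ → ℝ → ENNReal) → (ℝ → ENNReal) → ℝ → ENNReal
  | 0, _, e => e
  | n + 1, q, e => fun x => ∫⁻ y, q 0 x y * chainI n (fun k => q k.succ) e y

lemma chain_meas (n : ℕ) (q : Fin n → ℝ → ℝ → ENNReal) (e : ℝ → ENNReal)
    (hq : ∀ k, Measurable (Function.uncurry (q k))) (he : Measurable e) : Measurable (chainI n q e) := by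
  induction n with
  | zero => exact he
  | succ n ih =>
    have := ih (fun k => q k.succ) (fun k => hq k.succ)
    unfold chainI
    exact Measurable.lintegral_prod_right' (f := fun p : ℝ × ℝ => q 0 p.1 p.2 * chainI n (fun k => q k.succ) e p.2)
      ((hq 0).mul (this.comp measurable_snd))

lemma chain_pi (n : ℕ) (φ : ℝ → ENNReal) (q : Fin n → ℝ → ℝ → ENNReal) (e : ℝ → ENNReal)
    (hφ : Measurable φ) (hq : ∀ k, Measurable (Function.uncurry (q k))) (he : Measurable e) :
    ∫⁻ x : Fin (n + 1) → ℝ, φ (x 0) * ((∏ k : Fin n, q k (x k.castSucc) (x k.succ)) * e (x (Fin.last n))) =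
      ∫⁻ y, φ y * chainI n q e y := by
  induction n generalizing φ with
  | zero =>
    have := (volume_preserving_funUnique (Fin 1) ℝ).lintegral_comp (f := fun y => φ y * e y) (hφ.mul he)
    simp only [chainI]
    rw [← this]
    simp
    rfl
  | succ n ih =>
    have hm : ∀ y : ℝ, Measurable (q 0 y) := fun y => (hq 0).comp (measurable_const.prodMk measurable_id)
    have h1 := (volume_preserving_piFinSuccAbove (fun _ : Fin (n + 2) => ℝ) 0).lintegral_comp_emb
      (MeasurableEquiv.measurableEmbedding _)
      (fun p : ℝ × (Fin (n + 1) → ℝ) => φ p.1 * (q 0 p.1 (p.2 0) * ((∏ k : Fin n, q k.succ (p.2 k.castSucc) (p.2 k.succ)) * e (p.2 (Fin.last n)))))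
    have h2 : Measurable (fun p : ℝ × (Fin (n + 1) → ℝ) => (q 0 p.1 (p.2 0) * ((∏ k : Fin n, q k.succ (p.2 k.castSucc) (p.2 k.succ)) * e (p.2 (Fin.last n))))) := by
      refine ((hq 0).comp (f := fun p : ℝ × (Fin (n + 1) → ℝ) => (p.1, p.2 0)) (by fun_prop)).mul ?_
      refine Measurable.mul ?_ (he.comp (by fun_prop))
      refine Finset.measurable_fun_prod _ fun k _ => ?_
      exact (hq k.succ).comp (f := fun p : ℝ × (Fin (n + 1) → ℝ) => (p.2 k.castSucc, p.2 k.succ)) (by fun_prop)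
    have h3 : ∀ y : ℝ, φ y * chainI (n + 1) q e y = φ y * ∫⁻ x : Fin (n + 1) → ℝ, (q 0 y (x 0) * ((∏ k : Fin n, q k.succ (x k.castSucc) (x k.succ)) * e (x (Fin.last n)))) := by
      intro y
      rw [ih (q 0 y) (fun k => q k.succ) (hm y) (fun k => hq k.succ)]
      rfl
    simp_rw [h3]
    have h4 := lintegral_prod (μ := (volume : Measure ℝ)) (ν := (volume : Measure (Fin (n + 1) → ℝ)))
      (fun p : ℝ × (Fin (n + 1) → ℝ) => φ p.1 * (q 0 p.1 (p.2 0) * ((∏ k : Fin n, q k.succ (p.2 k.castSucc) (p.2 k.succ)) * e (p.2 (Fin.last n)))))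
      ((hφ.comp measurable_fst).mul h2).aemeasurable
    rw [← Measure.volume_eq_prod, ← h1] at h4
    have h5 : ∀ y : ℝ, φ y * ∫⁻ x : Fin (n + 1) → ℝ, (q 0 y (x 0) * ((∏ k : Fin n, q k.succ (x k.castSucc) (x k.succ)) * e (x (Fin.last n)))) =
      ∫⁻ x : Fin (n + 1) → ℝ, φ y * (q 0 y (x 0) * ((∏ k : Fin n, q k.succ (x k.castSucc) (x k.succ)) * e (x (Fin.last n)))) := by
      intro y
      rw [lintegral_const_mul]
      exact h2.comp (f := fun x : Fin (n + 1) → ℝ => (y, x)) (by fun_prop)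
    simp_rw [h5]
    rw [← h4]
    refine lintegral_congr fun x => ?_
    simp only [MeasurableEquiv.piFinSuccAbove_apply, Fin.insertNthEquiv_symm_apply, Fin.removeNth, Fin.succAbove_zero]
    rw [Fin.prod_univ_succ]
    simp only [Fin.castSucc_zero, Fin.succ_castSucc, Fin.succ_last, mul_assoc]

noncomputable def qL {n : ℕ} (a b : Fin n → ℝ) (k : Fin n) (w w' : ℝ) : ENNReal :=
  ENNReal.ofReal (gF (a k) w w' * Real.exp (-(b k * w')))

noncomputable def qR {n : ℕ} (a b : Fin n → ℝ) (k : Fin n) (x y : ℝ) : ENNReal :=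
  (Set.Ioi (0 : ℝ)).indicator (fun y => ENNReal.ofReal (Real.exp (-(a k * x / 2)) * transP (b k) x y)) y

lemma qL_meas {n : ℕ} (a b : Fin n → ℝ) (k : Fin n) : Measurable (Function.uncurry (qL a b k)) := by
  have := gF_meas (a k)
  exact (this.mul (by fun_prop)).ennreal_ofReal

lemma qR_meas {n : ℕ} (a b : Fin n → ℝ) (k : Fin n) : Measurable (Function.uncurry (qR a b k)) := by
  have := transP_meas (b k)
  have h : Measurable (fun p : ℝ × ℝ => ENNReal.ofReal (Real.exp (-(a k * p.1 / 2)) * transP (b k) p.1 p.2)) :=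
    (Measurable.mul (by fun_prop) this).ennreal_ofReal
  exact h.indicator (s := Prod.snd ⁻¹' (Set.Ioi (0 : ℝ))) (measurable_snd measurableSet_Ioi)

lemma good_chain (n : ℕ) (a b : Fin n → ℝ) (ha : ∀ k, 0 < a k) (hb : ∀ k, 0 < b k) (c : ℝ) (hc : 0 < c) :
    ∃ A B : ℝ → ℝ, GoodPair A B ∧
      (∀ w, 0 < w → chainI n (qL a b) (fun w => ENNReal.ofReal (ellF c w)) w = ENNReal.ofReal (A w)) ∧
      (∀ x, 0 < x → chainI n (qR a b) (fun x => ENNReal.ofReal (Real.exp (-(c * x / 2)))) x = ENNReal.ofReal (B x)) := by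
  induction n with
  | zero => exact ⟨_, _, good_base c hc, fun w _ => rfl, fun x _ => rfl⟩
  | succ n ih =>
    obtain ⟨A, B, hAB, hL, hR⟩ := ih (fun k => a k.succ) (fun k => b k.succ) (fun k => ha _) (fun k => hb _)
    obtain ⟨h1, h2, h3⟩ := good_step hAB (hb 0) (ha 0)
    obtain ⟨hA, hB, ⟨C, c', hc', hbd⟩, hw⟩ := id hAB
    refine ⟨_, _, h1, fun w hw0 => ?_, fun x hx0 => ?_⟩
    · rw [ofReal_integral_eq_lintegral_ofReal (h2 w hw0)]
      · rw [← lintegral_indicator measurableSet_Ioi]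
        refine lintegral_congr fun w' => ?_
        by_cases h : 0 < w'
        · rw [Set.indicator_of_mem (by exact h)]
          have := hL w' h
          rw [ENNReal.ofReal_mul (mul_nonneg (gF_nonneg _ _ _ (ha 0)) (Real.exp_pos _).le), ← this]
          rfl
        · rw [Set.indicator_of_notMem (by exact h)]
          simp [qL, gF, h]
      · refine (ae_restrict_iff' measurableSet_Ioi).2 (Filter.Eventually.of_forall fun w' hw' => ?_)
        exact mul_nonneg (mul_nonneg (gF_nonneg _ _ _ (ha 0)) (Real.exp_pos _).le) (hw w' hw').1
    · rw [ofReal_integral_eq_lintegral_ofReal (h3 x hx0)]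
      · rw [← lintegral_indicator measurableSet_Ioi]
        refine lintegral_congr fun y => ?_
        by_cases h : 0 < y
        · rw [Set.indicator_of_mem (by exact h), qR, Set.indicator_of_mem (by exact h)]
          have := hR y h
          rw [ENNReal.ofReal_mul (mul_nonneg (Real.exp_pos _).le (transP_nonneg (hb 0) hx0.le h.le)), ← this]
          rfl
        · rw [Set.indicator_of_notMem (by exact h), qR, Set.indicator_of_notMem (by exact h), zero_mul]
      · refine (ae_restrict_iff' measurableSet_Ioi).2 (Filter.Eventually.of_forall fun y hy => ?_)
        exact mul_nonneg (mul_nonneg (Real.exp_pos _).le (transP_nonneg (hb 0) hx0.le (le_of_lt hy))) (hbd y hy).1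

lemma L_int (n : ℕ) (a b : Fin n → ℝ) (b0 c τ : ℝ) (ha : ∀ k, 0 < a k) (A : ℝ → ℝ)
    (hA : ∀ w, 0 < w → chainI n (qL a b) (fun w => ENNReal.ofReal (ellF c w)) w = ENNReal.ofReal (A w))
    (hA0 : ∀ w, 0 < w → 0 ≤ A w) (hAm : Measurable A) :
    ∫ w : Fin (n + 1) → ℝ in Set.univ.pi fun _ => Set.Ioi (0 : ℝ),
      Real.exp (-(b0 * w 0 + ∑ k : Fin n, b k * w k.succ)) * (ellF τ (w 0) * ellF c (w (Fin.last n)) *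
        ∏ k : Fin n, gF (a k) (w k.castSucc) (w k.succ)) =
      ∫ w in Set.Ioi (0 : ℝ), ellF τ w * Real.exp (-(b0 * w)) * A w := by
  have hS : MeasurableSet (Set.univ.pi fun _ : Fin (n + 1) => Set.Ioi (0 : ℝ)) :=
    MeasurableSet.univ_pi fun _ => measurableSet_Ioi
  rw [integral_eq_lintegral_of_nonneg_ae, integral_eq_lintegral_of_nonneg_ae]
  · congr 1
    rw [← lintegral_indicator measurableSet_Ioi, ← lintegral_indicator hS]
    have := chain_pi n (fun w => ENNReal.ofReal (ellF τ w * Real.exp (-(b0 * w)))) (qL a b)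
      (fun w => ENNReal.ofReal (ellF c w)) (((ellF_meas τ).mul (by fun_prop)).ennreal_ofReal)
      (qL_meas a b) (ellF_meas c).ennreal_ofReal
    convert this using 1
    · refine lintegral_congr fun w => ?_
      by_cases h : w ∈ (Set.univ.pi fun _ : Fin (n + 1) => Set.Ioi (0 : ℝ))
      · rw [Set.indicator_of_mem h]
        simp only [qL]
        rw [← ENNReal.ofReal_prod_of_nonneg (fun k _ => mul_nonneg (gF_nonneg _ _ _ (ha k)) (Real.exp_pos _).le),
          ← ENNReal.ofReal_mul (Finset.prod_nonneg fun k _ => mul_nonneg (gF_nonneg _ _ _ (ha k)) (Real.exp_pos _).le),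
          ← ENNReal.ofReal_mul (mul_nonneg (ellF_nonneg _ _) (Real.exp_pos _).le)]
        congr 1
        rw [Finset.prod_mul_distrib, ← Real.exp_sum, neg_add, Real.exp_add, Finset.sum_neg_distrib]
        ring
      · rw [Set.indicator_of_notMem h]
        simp only [Set.mem_pi, Set.mem_univ, true_imp_iff, not_forall] at h
        obtain ⟨i, hi⟩ := h
        have hi : ¬ (0 < w i) := hi
        refine Fin.cases (fun hi => ?_) (fun k hi => ?_) i hi
        · simp [ellF, hi]
        · have h0 : (∏ k : Fin n, qL a b k (w k.castSucc) (w k.succ)) = 0 := by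
            apply Finset.prod_eq_zero (Finset.mem_univ k)
            simp [qL, gF, hi]
          rw [h0, zero_mul, mul_zero]
    · refine lintegral_congr fun w => ?_
      by_cases h : 0 < w
      · rw [Set.indicator_of_mem (by exact h), hA w h, ENNReal.ofReal_mul (mul_nonneg (ellF_nonneg _ _) (Real.exp_pos _).le)]
      · rw [Set.indicator_of_notMem (by exact h)]
        simp [ellF, h]
  · refine (ae_restrict_iff' measurableSet_Ioi).2 (Filter.Eventually.of_forall fun y hy => ?_)
    exact mul_nonneg (mul_nonneg (ellF_nonneg _ _) (Real.exp_pos _).le) (hA0 y hy)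
  · exact (((ellF_meas τ).mul (by fun_prop)).mul hAm).aestronglyMeasurable
  · refine Filter.Eventually.of_forall fun w => ?_
    exact mul_nonneg (Real.exp_pos _).le (mul_nonneg (mul_nonneg (ellF_nonneg _ _) (ellF_nonneg _ _))
      (Finset.prod_nonneg fun k _ => gF_nonneg _ _ _ (ha k)))
  · apply Measurable.aestronglyMeasurable
    refine Measurable.mul (by fun_prop) (Measurable.mul (Measurable.mul ?_ ?_) ?_)
    · exact (ellF_meas τ).comp (measurable_pi_apply 0)
    · exact (ellF_meas c).comp (measurable_pi_apply _)
    · refine Finset.measurable_fun_prod _ fun k _ => ?_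
      exact (gF_meas (a k)).comp (f := fun w : Fin (n + 1) → ℝ => (w k.castSucc, w k.succ)) (by fun_prop)

lemma R_int (n : ℕ) (a : Fin n → ℝ) (b : Fin (n + 1) → ℝ) (c : ℝ) (hb : ∀ k, 0 < b k) (A B : ℝ → ℝ)
    (hAB : GoodPair A B)
    (hB : ∀ x, 0 < x → chainI n (qR a (fun k => b k.succ)) (fun x => ENNReal.ofReal (Real.exp (-(c * x / 2)))) x = ENNReal.ofReal (B x))
    (φ : ℝ → ℝ) (hφ : Measurable φ) (hφ0 : ∀ x, 0 < x → 0 ≤ φ x) :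
    ∫ x : Fin (n + 2) → ℝ in Set.univ.pi fun _ => Set.Ioi (0 : ℝ),
      φ (x 0) * Real.exp (-(∑ k : Fin n, a k * x k.castSucc.succ / 2 + c * x (Fin.last (n + 1)) / 2)) *
        ∏ k : Fin (n + 1), transP (b k) (x k.castSucc) (x k.succ) =
      ∫ x in Set.Ioi (0 : ℝ), φ x * ∫ y in Set.Ioi (0 : ℝ), transP (b 0) x y * B y := by
  have hS : MeasurableSet (Set.univ.pi fun _ : Fin (n + 2) => Set.Ioi (0 : ℝ)) :=
    MeasurableSet.univ_pi fun _ => measurableSet_Ioi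
  obtain ⟨-, hBm, ⟨C, c', hc', hbd⟩, -⟩ := id hAB
  obtain ⟨t1, t2, -⟩ := transP_int hBm hc' hbd (hb 0)
  rw [integral_eq_lintegral_of_nonneg_ae, integral_eq_lintegral_of_nonneg_ae]
  · congr 1
    rw [← lintegral_indicator measurableSet_Ioi, ← lintegral_indicator hS]
    have := chain_pi (n + 1) ((Set.Ioi (0 : ℝ)).indicator (fun w => ENNReal.ofReal (φ w))) (qR (Fin.cons 0 a) b)
      (fun x => ENNReal.ofReal (Real.exp (-(c * x / 2)))) (hφ.ennreal_ofReal.indicator measurableSet_Ioi)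
      (qR_meas _ b) (by fun_prop)
    convert this using 1
    · refine lintegral_congr fun x => ?_
      by_cases h : x ∈ (Set.univ.pi fun _ : Fin (n + 2) => Set.Ioi (0 : ℝ))
      · rw [Set.indicator_of_mem h]
        have hx : ∀ i, 0 < x i := fun i => h i (Set.mem_univ i)
        have hp : ∀ k : Fin (n + 1), 0 ≤ Real.exp (-((Fin.cons 0 a : Fin (n + 1) → ℝ) k * x k.castSucc / 2)) * transP (b k) (x k.castSucc) (x k.succ) :=
          fun k => mul_nonneg (Real.exp_pos _).le (transP_nonneg (hb k) (hx _).le (hx _).le)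
        simp only [qR, Set.indicator_of_mem (show x _ ∈ Set.Ioi (0 : ℝ) from hx _)]
        rw [← ENNReal.ofReal_prod_of_nonneg (fun k _ => hp k),
          ← ENNReal.ofReal_mul (Finset.prod_nonneg fun k _ => hp k),
          ← ENNReal.ofReal_mul (hφ0 _ (hx _))]
        congr 1
        rw [Finset.prod_mul_distrib, ← Real.exp_sum, neg_add, Real.exp_add, Finset.sum_neg_distrib, Fin.sum_univ_succ (n := n)]
        simp only [Fin.cons_zero, Fin.cons_succ, zero_mul, zero_div, zero_add, Fin.succ_castSucc]
        ring
      · rw [Set.indicator_of_notMem h]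
        simp only [Set.mem_pi, Set.mem_univ, true_imp_iff, not_forall] at h
        obtain ⟨i, hi⟩ := h
        refine Fin.cases (fun hi => ?_) (fun k hi => ?_) i hi
        · rw [Set.indicator_of_notMem hi, zero_mul]
        · have h0 : (∏ k : Fin (n + 1), qR (Fin.cons 0 a) b k (x k.castSucc) (x k.succ)) = 0 := by
            apply Finset.prod_eq_zero (Finset.mem_univ k)
            rw [qR, Set.indicator_of_notMem hi]
          rw [h0, zero_mul, mul_zero]
    · refine lintegral_congr fun x => ?_
      by_cases h : 0 < x
      · rw [Set.indicator_of_mem (by exact h), Set.indicator_of_mem (by exact h), ENNReal.ofReal_mul (hφ0 x h)]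
        congr 1
        rw [ofReal_integral_eq_lintegral_ofReal (t1 x h.le), ← lintegral_indicator measurableSet_Ioi]
        · refine lintegral_congr fun y => ?_
          by_cases hy : 0 < y
          · rw [Set.indicator_of_mem (by exact hy), qR, Set.indicator_of_mem (by exact hy), ENNReal.ofReal_mul (transP_nonneg (hb 0) h.le hy.le), ← hB y hy]
            simp only [Fin.cons_zero, zero_mul, zero_div, neg_zero, Real.exp_zero, one_mul]
            rfl
          · rw [Set.indicator_of_notMem (by exact hy), qR, Set.indicator_of_notMem (by exact hy), zero_mul]
        · refine (ae_restrict_iff' measurableSet_Ioi).2 (Filter.Eventually.of_forall fun y hy => ?_)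
          exact mul_nonneg (transP_nonneg (hb 0) h.le (le_of_lt hy)) (hbd y hy).1
      · rw [Set.indicator_of_notMem (by exact h), Set.indicator_of_notMem (by exact h), zero_mul]
  · refine (ae_restrict_iff' measurableSet_Ioi).2 (Filter.Eventually.of_forall fun y hy => ?_)
    exact mul_nonneg (hφ0 y hy) (t2 y (le_of_lt hy))
  · exact (hφ.mul (Q_meas hBm _)).aestronglyMeasurable
  · refine (ae_restrict_iff' hS).2 (Filter.Eventually.of_forall fun x h => ?_)
    have hx : ∀ i, 0 < x i := fun i => h i (Set.mem_univ i)
    exact mul_nonneg (mul_nonneg (hφ0 _ (hx _)) (Real.exp_pos _).le)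
      (Finset.prod_nonneg fun k _ => transP_nonneg (hb k) (hx _).le (hx _).le)
  · apply Measurable.aestronglyMeasurable
    refine Measurable.mul (by fun_prop) ?_
    refine Finset.measurable_fun_prod _ fun k _ => ?_
    exact (transP_meas (b k)).comp (f := fun w : Fin (n + 2) → ℝ => (w k.castSucc, w k.succ)) (by fun_prop)

lemma dual_exists (n : ℕ) (a : Fin n → ℝ) (b : Fin (n + 1) → ℝ) (c : ℝ) (ha : ∀ k, 0 < a k)
    (hb : ∀ k, 0 < b k) (hc : 0 < c) :
    ∃ Q : ℝ → ℝ, Measurable Q ∧ (∀ x, 0 < x → 0 ≤ Q x) ∧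
      (∀ τ, 0 < τ → IntegrableOn (fun x => Real.sqrt x * Real.exp (-(τ * x / 2)) * Q x) (Set.Ioi 0)) ∧
      (∀ τ, 0 < τ → ∫ w : Fin (n + 1) → ℝ in Set.univ.pi fun _ => Set.Ioi (0 : ℝ),
        Real.exp (-(∑ k : Fin (n + 1), b k * w k)) * (ellF τ (w 0) * ellF c (w (Fin.last n)) *
        ∏ k : Fin n, gF (a k) (w k.castSucc) (w k.succ)) =
        1 / (4 * Real.pi) * ∫ x in Set.Ioi (0 : ℝ), Real.sqrt x * Real.exp (-(τ * x / 2)) * Q x) ∧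
      ∀ φ : ℝ → ℝ, Measurable φ → (∀ x, 0 < x → 0 ≤ φ x) →
        ∫ x : Fin (n + 2) → ℝ in Set.univ.pi fun _ => Set.Ioi (0 : ℝ),
          φ (x 0) * Real.exp (-(∑ k : Fin n, a k * x k.castSucc.succ / 2 + c * x (Fin.last (n + 1)) / 2)) *
          ∏ k : Fin (n + 1), transP (b k) (x k.castSucc) (x k.succ) =
        ∫ x in Set.Ioi (0 : ℝ), φ x * Q x := by
  obtain ⟨A, B, hAB, hA, hB⟩ := good_chain n a (fun k => b k.succ) ha (fun k => hb _) c hc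
  obtain ⟨hAm, hBm, ⟨C, c', hc', hbd⟩, hw⟩ := id hAB
  refine ⟨_, Q_meas hBm (b 0), fun x hx => (transP_int hBm hc' hbd (hb 0)).2.1 x hx.le,
    fun τ hτ => (good_final hAB (hb 0) hτ).2.1, fun τ hτ => ?_, fun φ h1 h2 => R_int n a b c hb A B hAB hB φ h1 h2⟩
  rw [← (good_final hAB (hb 0) hτ).2.2, ← L_int n a (fun k => b k.succ) (b 0) c τ ha A hA (fun w hw0 => (hw w hw0).1) hAm]
  simp_rw [Fin.sum_univ_succ]

lemma ellF_scale (v τ w : ℝ) (hv : 0 < v) : ellF (v * τ) (Real.sqrt v * w) = v⁻¹ * ellF τ w := by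
  have hs : 0 < Real.sqrt v := Real.sqrt_pos.2 hv
  unfold ellF
  by_cases h : 0 < w
  · rw [if_pos h, if_pos (mul_pos hs h)]
    have h1 : Real.sqrt (2 * Real.pi * (v * τ) ^ 3) = v * Real.sqrt v * Real.sqrt (2 * Real.pi * τ ^ 3) := by
      rw [show 2 * Real.pi * (v * τ) ^ 3 = v ^ 2 * (v * (2 * Real.pi * τ ^ 3)) by ring, Real.sqrt_mul (by positivity),
        Real.sqrt_mul hv.le, Real.sqrt_sq hv.le]
      ring
    have h2 : -((Real.sqrt v * w) ^ 2) / (2 * (v * τ)) = -(w ^ 2) / (2 * τ) := by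
      rw [mul_pow, Real.sq_sqrt hv.le]
      rw [show -(v * w ^ 2) = v * (-(w ^ 2)) by ring, show 2 * (v * τ) = v * (2 * τ) by ring, mul_div_mul_left _ _ hv.ne']
    rw [h1, h2]
    field_simp
  · rw [if_neg h, if_neg (fun h' => h (pos_of_mul_pos_right h' hs.le)), mul_zero]

lemma gF_scale (v τ a b : ℝ) (hv : 0 < v) :
    gF (v * τ) (Real.sqrt v * a) (Real.sqrt v * b) = (Real.sqrt v)⁻¹ * gF τ a b := by
  have hs : 0 < Real.sqrt v := Real.sqrt_pos.2 hv
  have hi : ∀ a, 0 < Real.sqrt v * a ↔ 0 < a := fun a => mul_pos_iff_of_pos_left hs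
  unfold gF
  simp only [hi]
  split_ifs with h
  · have h1 : Real.sqrt (2 * Real.pi * (v * τ)) = Real.sqrt v * Real.sqrt (2 * Real.pi * τ) := by
      rw [← Real.sqrt_mul hv.le]; ring_nf
    have h2 : ∀ w : ℝ, -((Real.sqrt v * w) ^ 2) / (2 * (v * τ)) = -(w ^ 2) / (2 * τ) := by
      intro w
      rw [mul_pow, Real.sq_sqrt hv.le]
      rw [show -(v * w ^ 2) = v * (-(w ^ 2)) by ring, show 2 * (v * τ) = v * (2 * τ) by ring, mul_div_mul_left _ _ hv.ne']
    rw [← mul_sub, ← mul_add, h1, h2, h2]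
    field_simp
  · simp

lemma gF_symm (τ a b : ℝ) : gF τ a b = gF τ b a := by
  unfold gF
  simp only [and_comm (a := 0 < a)]
  rw [show (a - b) ^ 2 = (b - a) ^ 2 by ring, add_comm a b]

open scoped Pointwise in
lemma pi_scale (m : ℕ) (G : (Fin m → ℝ) → ℝ) (R : ℝ) (hR : 0 < R) :
    ∫ u in Set.univ.pi fun _ => Set.Ioi (0 : ℝ), G u =
      R ^ m * ∫ u in Set.univ.pi fun _ => Set.Ioi (0 : ℝ), G (R • u) := by
  rw [Measure.setIntegral_comp_smul volume G _ hR.ne']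
  have : R • (Set.univ.pi fun _ : Fin m => Set.Ioi (0 : ℝ)) = Set.univ.pi fun _ => Set.Ioi (0 : ℝ) := by
    ext x
    rw [Set.mem_smul_set_iff_inv_smul_mem₀ hR.ne']
    simp only [Set.mem_pi, Set.mem_univ, true_imp_iff, Pi.smul_apply, Set.mem_Ioi, smul_eq_mul]
    exact forall_congr' fun i => mul_pos_iff_of_pos_left (inv_pos.2 hR)
  rw [this, abs_of_pos (by positivity), Module.finrank_fin_fun, smul_eq_mul, ← mul_assoc, mul_inv_cancel₀ (by positivity), one_mul]

lemma pi_rev (m : ℕ) (G : (Fin m → ℝ) → ℝ) :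
    ∫ u in Set.univ.pi fun _ => Set.Ioi (0 : ℝ), G u =
      ∫ u in Set.univ.pi fun _ => Set.Ioi (0 : ℝ), G (fun k => u k.rev) := by
  have h := volume_measurePreserving_piCongrLeft (fun _ : Fin m => ℝ) Fin.revPerm
  have h2 := h.setIntegral_preimage_emb (MeasurableEquiv.measurableEmbedding _) G (Set.univ.pi fun _ => Set.Ioi (0 : ℝ))
  have h3 : ∀ u : Fin m → ℝ, (MeasurableEquiv.piCongrLeft (fun _ : Fin m => ℝ) Fin.revPerm) u = fun k => u k.rev := by
    intro u
    ext k
    have := MeasurableEquiv.piCongrLeft_apply_apply (β := fun _ : Fin m => ℝ) Fin.revPerm u k.rev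
    simpa using this
  rw [← h2]
  simp_rw [h3]
  congr 1
  congr 1
  ext u
  simp only [Set.mem_preimage, h3, Set.mem_pi, Set.mem_univ, true_imp_iff]
  exact ⟨fun h i => by simpa using h i.rev, fun h i => h _⟩

lemma inner_eq (n : ℕ) (b : Fin (n + 1) → ℝ) (t : Fin (n + 3) → ℝ) (v : ℝ) (hv : 0 < v) :
    (∫ u : Fin (n + 1) → ℝ in Set.univ.pi fun _ => Set.Ioi (0 : ℝ),
          Real.exp (-(∑ k : Fin (n + 1), (b k.rev / Real.sqrt v) * u k)) *
            excDensity n (fun i => v * (1 - t i.rev.succ.castSucc)) u) =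
    Real.sqrt (8 * Real.pi) * (Real.sqrt v * v⁻¹ ^ 2) *
     ∫ w : Fin (n + 1) → ℝ in Set.univ.pi fun _ => Set.Ioi (0 : ℝ),
        Real.exp (-(∑ k : Fin (n + 1), b k * w k)) *
          (ellF (t 1 + (1 - v) / v) (w 0) * ellF (1 - t (Fin.last n).succ.castSucc) (w (Fin.last n)) *
        ∏ k : Fin n, gF (t k.succ.succ.castSucc - t k.castSucc.succ.castSucc) (w k.castSucc) (w k.succ)) := by
  have hs : 0 < Real.sqrt v := Real.sqrt_pos.2 hv
  rw [pi_scale _ _ _ hs, pi_rev, ← integral_const_mul, ← integral_const_mul]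
  refine setIntegral_congr_fun (MeasurableSet.univ_pi fun _ => measurableSet_Ioi) fun w _ => ?_
  have e1 : ∑ k : Fin (n + 1), (b k.rev / Real.sqrt v) * ((Real.sqrt v • fun k : Fin (n + 1) => w k.rev) k) = ∑ k : Fin (n + 1), b k * w k := by
    rw [← Equiv.sum_comp Fin.revPerm]
    refine Finset.sum_congr rfl fun k _ => ?_
    simp only [Pi.smul_apply, smul_eq_mul, Fin.revPerm_apply, Fin.rev_rev]
    field_simp
  have e2 : ∏ k : Fin n, gF (v * (1 - t k.succ.rev.succ.castSucc) - v * (1 - t k.castSucc.rev.succ.castSucc))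
      (Real.sqrt v * w k.castSucc.rev) (Real.sqrt v * w k.succ.rev) =
      (Real.sqrt v)⁻¹ ^ n * ∏ k : Fin n, gF (t k.succ.succ.castSucc - t k.castSucc.succ.castSucc) (w k.castSucc) (w k.succ) := by
    rw [← Equiv.prod_comp Fin.revPerm]
    have : ∀ k : Fin n, gF (v * (1 - t (Fin.revPerm k).succ.rev.succ.castSucc) - v * (1 - t (Fin.revPerm k).castSucc.rev.succ.castSucc))
      (Real.sqrt v * w (Fin.revPerm k).castSucc.rev) (Real.sqrt v * w (Fin.revPerm k).succ.rev) =
       (Real.sqrt v)⁻¹ * gF (t k.succ.succ.castSucc - t k.castSucc.succ.castSucc) (w k.castSucc) (w k.succ) := by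
      intro k
      rw [← gF_scale _ _ _ _ hv, gF_symm]
      simp only [Fin.revPerm_apply, Fin.rev_succ, Fin.rev_castSucc, Fin.rev_rev]
      congr 1
      ring
    simp_rw [this]
    rw [Finset.prod_mul_distrib]
    simp
  have e3 : excDensity n (fun i => v * (1 - t i.rev.succ.castSucc)) (Real.sqrt v • fun k : Fin (n + 1) => w k.rev) =
     Real.sqrt (8 * Real.pi) * (v⁻¹ * ellF (1 - t (Fin.last n).succ.castSucc) (w (Fin.last n))) *
       (v⁻¹ * ellF (t 1 + (1 - v) / v) (w 0)) * ((Real.sqrt v)⁻¹ ^ n * ∏ k : Fin n, gF (t k.succ.succ.castSucc - t k.castSucc.succ.castSucc) (w k.castSucc) (w k.succ)) := by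
    rw [← e2, ← ellF_scale _ _ _ hv, ← ellF_scale _ _ _ hv, excDensity]
    simp only [Pi.smul_apply, smul_eq_mul, Fin.rev_zero, Fin.rev_last]
    congr 3
    rw [show (Fin.succ (0 : Fin (n + 1))).castSucc = 1 from rfl]
    field_simp
    ring
  rw [e1, e3]
  rw [pow_succ]
  have h5 : Real.sqrt v ^ n * (Real.sqrt v)⁻¹ ^ n = 1 := by
    rw [← mul_pow, mul_inv_cancel₀ hs.ne', one_pow]
  linear_combination (Real.sqrt (8 * Real.pi) * (Real.sqrt v * v⁻¹ ^ 2) * (Real.exp (-(∑ k : Fin (n + 1), b k * w k)) *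
          (ellF (t 1 + (1 - v) / v) (w 0) * ellF (1 - t (Fin.last n).succ.castSucc) (w (Fin.last n)) *
        ∏ k : Fin n, gF (t k.succ.succ.castSucc - t k.castSucc.succ.castSucc) (w k.castSucc) (w k.succ)))) * h5

lemma subst_v (f : ℝ → ℝ) :
    ∫ v in Set.Ioo (0 : ℝ) 1, f v = ∫ r in Set.Ioi (0 : ℝ), (1 + r)⁻¹ ^ 2 * f ((1 + r)⁻¹) := by
  have himg : (fun r : ℝ => (1 + r)⁻¹) '' Set.Ioi 0 = Set.Ioo 0 1 := by
    ext v
    constructor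
    · rintro ⟨r, hr, rfl⟩
      have hr : (0 : ℝ) < r := hr
      exact ⟨by positivity, inv_lt_one_of_one_lt₀ (by linarith)⟩
    · rintro ⟨h0, h1⟩
      refine ⟨v⁻¹ - 1, ?_, by simp⟩
      have := (one_lt_inv₀ h0).2 h1
      show 0 < v⁻¹ - 1
      linarith
  rw [← himg, integral_image_eq_integral_abs_deriv_smul (f' := fun r => -1 / (1 + r) ^ 2) measurableSet_Ioi]
  · refine setIntegral_congr_fun measurableSet_Ioi fun r hr => ?_
    simp only [smul_eq_mul]
    congr 1
    rw [abs_div, abs_neg, abs_one, abs_of_nonneg (by positivity), inv_pow, one_div]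
  · intro r hr
    have hr : (0 : ℝ) < r := hr
    exact (((hasDerivAt_id r).const_add 1).inv (by simp; linarith)).hasDerivWithinAt
  · intro r _ r' _ h
    simpa using h

lemma swap_nonneg (f : ℝ → ℝ → ℝ) (hf : Measurable (Function.uncurry f))
    (h0 : ∀ r x, 0 < r → 0 < x → 0 ≤ f r x)
    (h1 : ∀ r, 0 < r → IntegrableOn (f r) (Set.Ioi 0))
    (h2 : ∀ x, 0 < x → IntegrableOn (fun r => f r x) (Set.Ioi 0)) :
    ∫ r in Set.Ioi (0 : ℝ), ∫ x in Set.Ioi (0 : ℝ), f r x = ∫ x in Set.Ioi (0 : ℝ), ∫ r in Set.Ioi (0 : ℝ), f r x := by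
  have ae : ∀ p : ℝ → Prop, (∀ x, 0 < x → p x) → ∀ᵐ x ∂(volume.restrict (Set.Ioi (0 : ℝ))), p x := fun p hp =>
    (ae_restrict_iff' measurableSet_Ioi).2 (Filter.Eventually.of_forall fun x hx => hp x hx)
  rw [integral_eq_lintegral_of_nonneg_ae, integral_eq_lintegral_of_nonneg_ae]
  · congr 1
    rw [lintegral_congr_ae (g := fun r => ∫⁻ x in Set.Ioi (0 : ℝ), ENNReal.ofReal (f r x)),
      lintegral_congr_ae (g := fun x => ∫⁻ r in Set.Ioi (0 : ℝ), ENNReal.ofReal (f r x))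
      (f := fun x => ENNReal.ofReal (∫ r in Set.Ioi (0 : ℝ), f r x))]
    · exact lintegral_lintegral_swap hf.ennreal_ofReal.aemeasurable
    · exact ae _ fun x hx => ofReal_integral_eq_lintegral_ofReal (h2 x hx) (ae _ fun r hr => h0 r x hr hx)
    · exact ae _ fun r hr => ofReal_integral_eq_lintegral_ofReal (h1 r hr) (ae _ fun x hx => h0 r x hr hx)
  · exact ae _ fun x hx => setIntegral_nonneg measurableSet_Ioi fun r hr => h0 r x hr hx
  · exact (StronglyMeasurable.integral_prod_left (f := fun r x => f r x) hf.stronglyMeasurable).aestronglyMeasurable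
  · exact ae _ fun r hr => setIntegral_nonneg measurableSet_Ioi fun x hx => h0 r x hr hx
  · exact (StronglyMeasurable.integral_prod_right (f := fun r x => f r x) hf.stronglyMeasurable).aestronglyMeasurable

lemma psi_int (β e y : ℝ) (hβ : 0 < β) (hy : 0 < y) :
    IntegrableOn (fun u : ℝ => Real.exp (-(y * u)) * u ^ (β - 1) * (1 + u) ^ e) (Set.Ioi 0) := by
  set ε : ℝ := y / (2 * (|e| + 1)) with hε
  have hε0 : 0 < ε := by positivity
  have h1 : IntegrableOn (fun u : ℝ => Real.exp (|e| * (ε - 1 - Real.log ε)) * (u ^ (β - 1) * Real.exp (-(y / 2) * u ^ (1 : ℝ)))) (Set.Ioi 0) :=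
    (integrableOn_rpow_mul_exp_neg_mul_rpow (by linarith) (by norm_num) (by positivity)).const_mul _
  refine Integrable.mono' h1 (by fun_prop) ?_
  refine (ae_restrict_iff' measurableSet_Ioi).2 (Filter.Eventually.of_forall fun u hu => ?_)
  have hu : (0 : ℝ) < u := hu
  have hu1 : 0 < 1 + u := by linarith
  rw [Real.norm_eq_abs, abs_of_nonneg (by positivity), Real.rpow_one, Real.rpow_def_of_pos hu1]
  have hl : Real.log (1 + u) ≤ ε * (1 + u) - 1 - Real.log ε := by
    have := Real.log_le_sub_one_of_pos (mul_pos hε0 hu1)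
    rw [Real.log_mul hε0.ne' hu1.ne'] at this
    linarith
  have hl0 : 0 ≤ Real.log (1 + u) := Real.log_nonneg (by linarith)
  have h3 : Real.log (1 + u) * e ≤ |e| * (ε - 1 - Real.log ε) + y / 2 * u := by
    have a1 : Real.log (1 + u) * e ≤ |e| * Real.log (1 + u) := by
      rw [mul_comm]; exact mul_le_mul_of_nonneg_right (le_abs_self e) hl0
    have a2 := mul_le_mul_of_nonneg_left hl (abs_nonneg e)
    have a3 : |e| * ε ≤ y / 2 := by
      rw [hε, ← mul_div_assoc, div_le_div_iff₀ (by positivity) (by norm_num)]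
      nlinarith [abs_nonneg e]
    nlinarith [mul_le_mul_of_nonneg_right a3 hu.le]
  have h4 : Real.exp (-(y * u)) * Real.exp (Real.log (1 + u) * e) ≤ Real.exp (|e| * (ε - 1 - Real.log ε)) * Real.exp (-(y / 2) * u) := by
    rw [← Real.exp_add, ← Real.exp_add]
    apply Real.exp_le_exp.2
    linarith
  have := mul_le_mul_of_nonneg_left h4 (Real.rpow_nonneg hu.le (β - 1))
  linarith

/-- **Dual representation for Beta-randomized Brownian meanders.**
Here `ν` is the `Beta(α,β)` distribution with density
`v^{α−1}(1−v)^{β−1}/B(α,β)` on `(0,1)`, where `B(α,β) = Γ(α)Γ(β)/Γ(α+β)`;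
`d = n + 1 ≥ 1`, `s₀ = 0 < s₁ < … < s_d`, `t₀ = 0 ≤ t₁ < … < t_d < 1 = t_{d+1}`. -/
theorem beta_meander_dual (α β : ℝ) (hα : 0 < α) (hβ : 0 < β)
    (n : ℕ) (s : Fin (n + 2) → ℝ) (t : Fin (n + 3) → ℝ)
    (hs0 : s 0 = 0) (hs : StrictMono s)
    (ht0 : t 0 = 0) (htlast : t (Fin.last (n + 2)) = 1)
    (ht1 : 0 ≤ t 1)
    (htmono : StrictMonoOn t (Set.Icc (1 : Fin (n + 3)) ⟨n + 1, by omega⟩))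
    (htd : t ⟨n + 1, by omega⟩ < 1) :
    (∫ v in Set.Ioo (0 : ℝ) 1,
        (∫ u : Fin (n + 1) → ℝ in Set.univ.pi fun _ => Set.Ioi (0 : ℝ),
          Real.exp (-(∑ k : Fin (n + 1),
              ((s k.rev.succ - s k.rev.castSucc) / Real.sqrt v) * u k)) *
            excDensity n (fun i => v * (1 - t i.rev.succ.castSucc)) u) *
          (v ^ (α - 1) * (1 - v) ^ (β - 1) /
            (Real.Gamma α * Real.Gamma β / Real.Gamma (α + β)))) =
      (Real.Gamma (α + β) / (Real.sqrt (2 * Real.pi) * Real.Gamma α)) *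
        ∫ x : Fin (n + 2) → ℝ in Set.univ.pi fun _ => Set.Ioi (0 : ℝ),
          Real.sqrt (x 0) * psiCH β (5 / 2 - α) (x 0 / 2) *
            Real.exp (-(1 / 2 : ℝ) * ∑ k : Fin (n + 2), (t k.succ - t k.castSucc) * x k) *
            ∏ k : Fin (n + 1), transP (s k.succ - s k.castSucc) (x k.castSucc) (x k.succ) := by
  set b : Fin (n + 1) → ℝ := fun k => s k.succ - s k.castSucc with hb
  set a : Fin n → ℝ := fun k => t k.succ.succ.castSucc - t k.castSucc.succ.castSucc with ha
  set c : ℝ := 1 - t (Fin.last n).succ.castSucc with hc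
  have hb0 : ∀ k, 0 < b k := fun k => sub_pos.2 (hs (Fin.castSucc_lt_succ))
  have ha0 : ∀ k, 0 < a k := fun k => by
    refine sub_pos.2 (htmono ?_ ?_ ?_)
    · simp only [Set.mem_Icc, Fin.le_def, Fin.val_castSucc, Fin.val_succ, Fin.val_one]
      omega
    · simp only [Set.mem_Icc, Fin.le_def, Fin.val_castSucc, Fin.val_succ, Fin.val_one]
      omega
    · simp only [Fin.lt_def, Fin.val_castSucc, Fin.val_succ]
      omega
  have hc0 : 0 < c := sub_pos.2 htd
  obtain ⟨Q, hQm, hQ0, hQi, hL, hR⟩ := dual_exists n a b c ha0 hb0 hc0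
  have hψm : Measurable (fun x => psiCH β (5 / 2 - α) (x / 2)) := by
    unfold psiCH
    refine Measurable.const_mul ?_ _
    apply StronglyMeasurable.measurable
    apply StronglyMeasurable.integral_prod_right
      (f := fun x u : ℝ => Real.exp (-(x / 2 * u)) * u ^ (β - 1) * (1 + u) ^ (5 / 2 - α - β - 1))
    apply Measurable.stronglyMeasurable
    unfold Function.uncurry
    fun_prop
  have hψ0 : ∀ x, 0 < x → 0 ≤ psiCH β (5 / 2 - α) (x / 2) := by
    intro x hx
    unfold psiCH
    refine mul_nonneg (one_div_nonneg.2 (Real.Gamma_pos_of_pos hβ).le) (setIntegral_nonneg measurableSet_Ioi fun u hu => ?_)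
    have hu : (0 : ℝ) < u := hu
    positivity
  -- right-hand side
  have hRHS := hR (fun x => Real.sqrt x * psiCH β (5 / 2 - α) (x / 2) * Real.exp (-(t 1 * x / 2)))
    (by fun_prop) (fun x hx => mul_nonneg (mul_nonneg (Real.sqrt_nonneg _) (hψ0 x hx)) (Real.exp_pos _).le)
  have hR2 : ∫ x : Fin (n + 2) → ℝ in Set.univ.pi fun _ => Set.Ioi (0 : ℝ),
          Real.sqrt (x 0) * psiCH β (5 / 2 - α) (x 0 / 2) *
            Real.exp (-(1 / 2 : ℝ) * ∑ k : Fin (n + 2), (t k.succ - t k.castSucc) * x k) *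
            ∏ k : Fin (n + 1), transP (s k.succ - s k.castSucc) (x k.castSucc) (x k.succ) =
      ∫ x in Set.Ioi (0 : ℝ), Real.sqrt x * psiCH β (5 / 2 - α) (x / 2) * Real.exp (-(t 1 * x / 2)) * Q x := by
    rw [← hRHS]
    refine setIntegral_congr_fun (MeasurableSet.univ_pi fun _ => measurableSet_Ioi) fun x _ => ?_
    have e : Real.exp (-(1 / 2 : ℝ) * ∑ k : Fin (n + 2), (t k.succ - t k.castSucc) * x k) =
        Real.exp (-(t 1 * x 0 / 2)) *
        Real.exp (-(∑ k : Fin n, a k * x k.castSucc.succ / 2 + c * x (Fin.last (n + 1)) / 2)) := by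
      rw [← Real.exp_add, Fin.sum_univ_succ, Fin.sum_univ_castSucc]
      congr 1
      have e1 : t (Fin.succ (0 : Fin (n + 2))) = t 1 := rfl
      have e2 : t (Fin.castSucc (0 : Fin (n + 2))) = 0 := ht0
      have e3 : t (Fin.last n).succ.succ = 1 := htlast
      rw [e1, e2, e3, ← Finset.sum_div]
      have e4 : ∀ k : Fin n, (t k.castSucc.succ.succ - t k.castSucc.succ.castSucc) * x k.castSucc.succ = a k * x k.castSucc.succ := fun k => rfl
      simp_rw [e4]
      simp only [hc, Fin.succ_last]
      ring
    beta_reduce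
    rw [e]
    ring
  rw [hR2, subst_v]
  -- left-hand side
  set K : ℝ := Real.Gamma (α + β) / (Real.sqrt (2 * Real.pi) * Real.Gamma α * Real.Gamma β) with hK
  have hΓa := Real.Gamma_pos_of_pos hα
  have hΓb := Real.Gamma_pos_of_pos hβ
  have hΓab := Real.Gamma_pos_of_pos (add_pos hα hβ)
  have hin : ∀ r ∈ Set.Ioi (0 : ℝ),
     (1 + r)⁻¹ ^ 2 * ((∫ u : Fin (n + 1) → ℝ in Set.univ.pi fun _ => Set.Ioi (0 : ℝ),
          Real.exp (-(∑ k : Fin (n + 1),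
              ((s k.rev.succ - s k.rev.castSucc) / Real.sqrt (1 + r)⁻¹) * u k)) *
            excDensity n (fun i => (1 + r)⁻¹ * (1 - t i.rev.succ.castSucc)) u) *
          ((1 + r)⁻¹ ^ (α - 1) * (1 - (1 + r)⁻¹) ^ (β - 1) /
            (Real.Gamma α * Real.Gamma β / Real.Gamma (α + β)))) =
      K * ∫ x in Set.Ioi (0 : ℝ), Real.sqrt x * Real.exp (-((t 1 + r) * x / 2)) * Q x *
        (r ^ (β - 1) * (1 + r) ^ (5 / 2 - α - β - 1)) := by
    intro r hr
    have hr : (0 : ℝ) < r := hr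
    have hr1 : 0 < 1 + r := by linarith
    have h1 := inner_eq n b t (1 + r)⁻¹ (by positivity)
    have h2 : (1 - (1 + r)⁻¹) / (1 + r)⁻¹ = r := by field_simp; ring
    rw [h2] at h1
    rw [hL (t 1 + r) (by linarith)] at h1
    rw [h1, integral_mul_const]
    have h3 : 1 - (1 + r)⁻¹ = r * (1 + r)⁻¹ := by field_simp; ring
    have h4 : (1 + r)⁻¹ ^ 2 * (Real.sqrt (1 + r)⁻¹ * (1 + r)⁻¹⁻¹ ^ 2) * ((1 + r)⁻¹ ^ (α - 1) * (1 - (1 + r)⁻¹) ^ (β - 1)) =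
        r ^ (β - 1) * (1 + r) ^ (5 / 2 - α - β - 1) := by
      rw [h3, Real.mul_rpow hr.le (by positivity), Real.sqrt_eq_rpow, Real.inv_rpow hr1.le, Real.inv_rpow hr1.le, Real.inv_rpow hr1.le,
        ← Real.rpow_neg hr1.le, ← Real.rpow_neg hr1.le, ← Real.rpow_neg hr1.le, inv_inv, inv_pow,
        show 5 / 2 - α - β - 1 = -(1 / 2) + -(α - 1) + -(β - 1) by ring, Real.rpow_add hr1, Real.rpow_add hr1]
      field_simp
    have h5 : Real.sqrt (8 * Real.pi) = 2 * Real.sqrt (2 * Real.pi) := by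
      rw [show 8 * Real.pi = 2 ^ 2 * (2 * Real.pi) by ring, Real.sqrt_mul (by norm_num), Real.sqrt_sq (by norm_num)]
    have h6 : Real.sqrt (2 * Real.pi) * Real.sqrt (2 * Real.pi) = 2 * Real.pi := Real.mul_self_sqrt (by positivity)
    have h7 : Real.sqrt (8 * Real.pi) * (1 / (4 * Real.pi)) / (Real.Gamma α * Real.Gamma β / Real.Gamma (α + β)) = K := by
      rw [hK, h5]
      have : 0 < Real.sqrt (2 * Real.pi) := by positivity
      rw [show 4 * Real.pi = 2 * (Real.sqrt (2 * Real.pi) * Real.sqrt (2 * Real.pi)) by rw [h6]; ring]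
      field_simp
    rw [← h4, ← h7]
    ring
  rw [setIntegral_congr_fun measurableSet_Ioi hin, integral_const_mul]
  rw [swap_nonneg (fun r x => Real.sqrt x * Real.exp (-((t 1 + r) * x / 2)) * Q x *
        (r ^ (β - 1) * (1 + r) ^ (5 / 2 - α - β - 1)))]
  · have hx : ∀ x ∈ Set.Ioi (0 : ℝ), ∫ r in Set.Ioi (0 : ℝ), Real.sqrt x * Real.exp (-((t 1 + r) * x / 2)) * Q x *
        (r ^ (β - 1) * (1 + r) ^ (5 / 2 - α - β - 1)) =
        Real.Gamma β * (Real.sqrt x * psiCH β (5 / 2 - α) (x / 2) * Real.exp (-(t 1 * x / 2)) * Q x) := by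
      intro x _
      have h1 : ∀ r : ℝ, Real.sqrt x * Real.exp (-((t 1 + r) * x / 2)) * Q x *
        (r ^ (β - 1) * (1 + r) ^ (5 / 2 - α - β - 1)) =
        (Real.sqrt x * Real.exp (-(t 1 * x / 2)) * Q x) * (Real.exp (-(x / 2 * r)) * r ^ (β - 1) * (1 + r) ^ (5 / 2 - α - β - 1)) := by
        intro r
        rw [show -((t 1 + r) * x / 2) = -(t 1 * x / 2) + -(x / 2 * r) by ring, Real.exp_add]
        ring
      simp_rw [h1]
      rw [integral_const_mul, psiCH]
      field_simp
    rw [setIntegral_congr_fun measurableSet_Ioi hx, integral_const_mul, hK]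
    generalize (∫ x in Set.Ioi (0 : ℝ), Real.sqrt x * psiCH β (5 / 2 - α) (x / 2) * Real.exp (-(t 1 * x / 2)) * Q x) = I
    field_simp
  · unfold Function.uncurry
    fun_prop
  · intro r x hr hx
    have := hQ0 x hx
    positivity
  · intro r hr
    exact (hQi (t 1 + r) (by linarith)).mul_const _
  · intro x hx
    have := (psi_int β (5 / 2 - α - β - 1) (x / 2) hβ (by positivity)).const_mul (Real.sqrt x * Real.exp (-(t 1 * x / 2)) * Q x)
    refine Integrable.congr this (Filter.Eventually.of_forall fun r => ?_)
    beta_reduce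
    rw [show -((t 1 + r) * x / 2) = -(t 1 * x / 2) + -(x / 2 * r) by ring, Real.exp_add]
    ring
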